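/- arXiv:1902.10185 — 11 statements merged into one kernel-verified Lean document; each statement's English description precedes it below -/
import Mathlib

section
/- Let X be a topological space, let U be a θ-open subset of X, and let V be a subset of U which is θ-open in the subspace U (with its subspace topology). Then V is θ-open in X. -/
open Set Topology TopologicalSpace

universe u v w

/-- A set `U` in a topological space is *θ-open* if each of its points has an open
neighborhood whose closure is contained in `U`. -/
def IsThetaOpen {X : Type*} [TopologicalSpace X] (U : Set X) : Prop :=
  ∀ x ∈ U, ∃ O : Set X, IsOpen O ∧ x ∈ O ∧ closure O ⊆ U

/-- `V` is a θ-open subset of the subspace `A ⊆ X` (with its subspace topology). -/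
def IsThetaOpenIn {X : Type*} [TopologicalSpace X] (V A : Set X) : Prop :=
  V ⊆ A ∧ IsThetaOpen ((Subtype.val ⁻¹' V) : Set A)

/-- `C(f|A)`: the set of points of `A` at which the restriction `f|A : A → Y`
(with `A` carrying the subspace topology) is continuous. -/
def ContPts {X Y : Type*} [TopologicalSpace X] [TopologicalSpace Y] (f : X → Y) (A : Set X) :
    Set X :=
  {x | ∃ hx : x ∈ A, ContinuousAt (A.restrict f) ⟨x, hx⟩}

/-- `f` is scatteredly continuous if for every nonempty `A ⊆ X` the set `C(f|A)` is nonempty. -/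
def ScatteredlyContinuous {X Y : Type*} [TopologicalSpace X] [TopologicalSpace Y]
    (f : X → Y) : Prop :=
  ∀ A : Set X, A.Nonempty → (ContPts f A).Nonempty

/-- `f` is weakly discontinuous if for every nonempty `A ⊆ X` the set `C(f|A)` has
nonempty interior in `A`. -/
def WeaklyDiscontinuous {X Y : Type*} [TopologicalSpace X] [TopologicalSpace Y]
    (f : X → Y) : Prop :=
  ∀ A : Set X, A.Nonempty → (interior ((Subtype.val ⁻¹' ContPts f A) : Set A)).Nonempty

/-- `f` is θ-weakly discontinuous if for every nonempty `A ⊆ X` the set `C(f|A)` contains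
a nonempty θ-open subset of the subspace `A`. -/
def ThetaWeaklyDiscontinuous {X Y : Type*} [TopologicalSpace X] [TopologicalSpace Y]
    (f : X → Y) : Prop :=
  ∀ A : Set X, A.Nonempty → ∃ V : Set X, V.Nonempty ∧ V ⊆ ContPts f A ∧ IsThetaOpenIn V A

/-- `X` is sw-regular if every scatteredly continuous function from any topological space
to `X` is weakly discontinuous. -/
def SwRegular.{t, s} (X : Type s) [TopologicalSpace X] : Prop :=
  ∀ (Z : Type t) (_ : TopologicalSpace Z) (f : Z → X),
    ScatteredlyContinuous f → WeaklyDiscontinuous f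

/-- `X` is wθ-regular if every weakly discontinuous function from `X` to any topological
space is θ-weakly discontinuous. -/
def WThetaRegular.{t, s} (X : Type s) [TopologicalSpace X] : Prop :=
  ∀ (Y : Type t) (_ : TopologicalSpace Y) (f : X → Y),
    WeaklyDiscontinuous f → ThetaWeaklyDiscontinuous f

/-- A bijection (given as an equivalence) is a θ-weak homeomorphism if it and its inverse
are θ-weakly discontinuous. -/
def IsThetaWeakHomeomorph {X Y : Type*} [TopologicalSpace X] [TopologicalSpace Y]
    (e : X ≃ Y) : Prop :=
  ThetaWeaklyDiscontinuous (e : X → Y) ∧ ThetaWeaklyDiscontinuous (e.symm : Y → X)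

/-- A bijection (given as an equivalence) is a weak homeomorphism if it and its inverse
are weakly discontinuous. -/
def IsWeakHomeomorph {X Y : Type*} [TopologicalSpace X] [TopologicalSpace Y]
    (e : X ≃ Y) : Prop :=
  WeaklyDiscontinuous (e : X → Y) ∧ WeaklyDiscontinuous (e.symm : Y → X)

/-- `X` is θ-weakly regular if it is θ-weakly homeomorphic to a regular space. -/
def ThetaWeaklyRegular.{t, s} (X : Type s) [TopologicalSpace X] : Prop :=
  ∃ (Y : Type t) (_ : TopologicalSpace Y), RegularSpace Y ∧
    ∃ e : X ≃ Y, IsThetaWeakHomeomorph e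

/-- `X` is weakly regular if it is weakly homeomorphic to a regular space. -/
def WeaklyRegular.{t, s} (X : Type s) [TopologicalSpace X] : Prop :=
  ∃ (Y : Type t) (_ : TopologicalSpace Y), RegularSpace Y ∧
    ∃ e : X ≃ Y, IsWeakHomeomorph e

theorem isThetaOpen_of_isThetaOpenIn {X : Type u} [TopologicalSpace X] {U V : Set X}
    (hU : IsThetaOpen U) (hV : IsThetaOpenIn V U) : IsThetaOpen V := by
  intro x hx
  obtain ⟨O, hO, hxO, hOU⟩ := hU x (hV.1 hx)
  obtain ⟨_, ⟨W, hW, rfl⟩, hxW, hWV⟩ := hV.2 ⟨x, hV.1 hx⟩ hx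
  refine ⟨O ∩ W, hO.inter hW, ⟨hxO, hxW⟩, fun y hy ↦ ?_⟩
  have hyU : y ∈ U := hOU (closure_mono inter_subset_left hy)
  have hsub : O ∩ W ⊆ Subtype.val '' (Subtype.val ⁻¹' W : Set U) :=
    fun z hz ↦ ⟨⟨z, hOU (subset_closure hz.1)⟩, hz.2, rfl⟩
  have hyW : (⟨y, hyU⟩ : U) ∈ closure (Subtype.val ⁻¹' W) :=
    closure_subtype.2 (closure_mono hsub hy)
  exact hWV hyW
end

section
/- Let X be a regular topological space and Y an arbitrary topological space. A function f : X → Y is weakly discontinuous if and only if it is θ-weakly discontinuous. -/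
open Set Topology TopologicalSpace

universe u v w

theorem IsThetaOpen.isOpen {X : Type*} [TopologicalSpace X] {U : Set X} (hU : IsThetaOpen U) :
    IsOpen U := by
  refine isOpen_iff_forall_mem_open.2 fun x hx => ?_
  obtain ⟨O, hO, hxO, hOU⟩ := hU x hx
  exact ⟨O, subset_closure.trans hOU, hO, hxO⟩

theorem IsOpen.isThetaOpen {X : Type*} [TopologicalSpace X] [RegularSpace X] {U : Set X}
    (hU : IsOpen U) : IsThetaOpen U := by
  intro x hx
  obtain ⟨K, hK, hKc, hKU⟩ := exists_mem_nhds_isClosed_subset (hU.mem_nhds hx)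
  exact ⟨interior K, isOpen_interior, mem_interior_iff_mem_nhds.2 hK,
    (closure_minimal interior_subset hKc).trans hKU⟩

theorem weaklyDiscontinuous_iff_thetaWeaklyDiscontinuous_of_regular_domain
    {X : Type u} {Y : Type v} [TopologicalSpace X] [TopologicalSpace Y] [RegularSpace X]
    (f : X → Y) : WeaklyDiscontinuous f ↔ ThetaWeaklyDiscontinuous f := by
  constructor
  · intro h A hA
    obtain ⟨x, hx⟩ := h A hA
    refine ⟨Subtype.val '' interior (Subtype.val ⁻¹' ContPts f A : Set A), ⟨x, x, hx, rfl⟩,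
      image_subset_iff.2 interior_subset, Subtype.coe_image_subset A _, ?_⟩
    rw [preimage_image_eq _ Subtype.val_injective]
    exact isOpen_interior.isThetaOpen
  · intro h A hA
    obtain ⟨V, ⟨x, hx⟩, hVC, hVA, hV⟩ := h A hA
    exact ⟨⟨x, hVA hx⟩, interior_maximal (preimage_mono hVC) hV.isOpen hx⟩
end

section
/- Let X be an arbitrary topological space and Y a regular topological space. A function f : X → Y is scatteredly continuous if and only if it is weakly discontinuous. -/
open Set Topology TopologicalSpace

universe u v w

theorem mem_contPts_iff {X Y : Type*} [TopologicalSpace X] [TopologicalSpace Y] {f : X → Y}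
    {A : Set X} {x : X} : x ∈ ContPts f A ↔ x ∈ A ∧ ContinuousWithinAt f A x :=
  ⟨fun ⟨hx, h⟩ => ⟨hx, (continuousWithinAt_iff_continuousAt_domRestrict f hx).2 h⟩,
    fun ⟨hx, h⟩ => ⟨hx, (continuousWithinAt_iff_continuousAt_domRestrict f hx).1 h⟩⟩

/-- Into a regular space, continuity at `x` relative to a dense subset `D` of `A` extends to
continuity relative to `A`, provided `f` is continuous relative to `A` at the points of `A \ D`. -/
theorem ContinuousWithinAt.of_subset_closure {X Y : Type*} [TopologicalSpace X]
    [TopologicalSpace Y] [RegularSpace Y] {f : X → Y} {A D : Set X} {x : X}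
    (hDA : D ⊆ A) (hAD : A ⊆ closure D) (hf : ∀ a ∈ A \ D, ContinuousWithinAt f A a)
    (hx : ContinuousWithinAt f D x) : ContinuousWithinAt f A x := by
  refine (closed_nhds_basis (f x)).tendsto_right_iff.2 fun V ⟨hV, hVc⟩ => ?_
  obtain ⟨U, hU, hxU, hUV⟩ := mem_nhdsWithin.1 (hx hV)
  refine mem_nhdsWithin.2 ⟨U, hU, hxU, fun a ⟨haU, haA⟩ => ?_⟩
  by_cases haD : a ∈ D
  · exact hUV ⟨haU, haD⟩
  · have hcl : a ∈ closure (U ∩ D) := hU.inter_closure ⟨haU, hAD haA⟩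
    have hcont : ContinuousWithinAt f (U ∩ D) a :=
      (hf a ⟨haA, haD⟩).mono (inter_subset_right.trans hDA)
    exact hVc.closure_subset (hcont.mem_closure hcl hUV)

theorem WeaklyDiscontinuous.scatteredlyContinuous {X Y : Type*} [TopologicalSpace X]
    [TopologicalSpace Y] {f : X → Y} (h : WeaklyDiscontinuous f) : ScatteredlyContinuous f :=
  fun A hA => (h A hA).elim fun x hx => ⟨x, mem_preimage.1 (interior_subset hx)⟩

theorem ScatteredlyContinuous.weaklyDiscontinuous {X Y : Type*} [TopologicalSpace X]
    [TopologicalSpace Y] [RegularSpace Y] {f : X → Y} (h : ScatteredlyContinuous f) :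
    WeaklyDiscontinuous f := by
  intro A hA
  by_contra hempty
  have hdense : A ⊆ closure (A \ ContPts f A) := by
    have hd : Dense ((Subtype.val ⁻¹' ContPts f A : Set A)ᶜ) :=
      interior_eq_empty_iff_dense_compl.1 (not_nonempty_iff_eq_empty.1 hempty)
    have himage : Subtype.val '' ((Subtype.val ⁻¹' ContPts f A : Set A)ᶜ) =
        A \ ContPts f A := by
      rw [← preimage_compl, Subtype.image_preimage_coe, sdiff_eq]
    simpa only [himage] using Subtype.dense_iff.1 hd
  obtain ⟨x, hx⟩ := h _ (closure_nonempty_iff.1 (hA.mono hdense))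
  obtain ⟨⟨hxA, hxC⟩, hxD⟩ := mem_contPts_iff.1 hx
  refine hxC (mem_contPts_iff.2 ⟨hxA, hxD.of_subset_closure sdiff_subset hdense ?_⟩)
  intro a ⟨haA, haD⟩
  by_contra hac
  exact haD ⟨haA, fun hC => hac (mem_contPts_iff.1 hC).2⟩

theorem scatteredlyContinuous_iff_weaklyDiscontinuous_of_regular_codomain
    {X : Type u} {Y : Type v} [TopologicalSpace X] [TopologicalSpace Y] [RegularSpace Y]
    (f : X → Y) : ScatteredlyContinuous f ↔ WeaklyDiscontinuous f := by
  exact ⟨ScatteredlyContinuous.weaklyDiscontinuous, WeaklyDiscontinuous.scatteredlyContinuous⟩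
end

section
/- A topological space X is wθ-regular if and only if for each subspace A ⊆ X, each nonempty open subset U of A (in the subspace topology) contains a nonempty subset that is θ-open in A. -/
open Set Topology TopologicalSpace

universe u v w

/-- θ-openness in a subspace, expressed through the topology of the ambient space. -/
theorem isThetaOpenIn_iff {X : Type*} [TopologicalSpace X] {V A : Set X} :
    IsThetaOpenIn V A ↔
      V ⊆ A ∧ ∀ x ∈ V, ∃ O : Set X, IsOpen O ∧ x ∈ O ∧ A ∩ closure (A ∩ O) ⊆ V := by
  refine and_congr_right fun hVA => ⟨fun h x hx => ?_, fun h x hx => ?_⟩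
  · obtain ⟨_, ⟨O, hO, rfl⟩, hxO, hcl⟩ := h ⟨x, hVA hx⟩ hx
    refine ⟨O, hO, hxO, fun y hy => @hcl ⟨y, hy.1⟩ ?_⟩
    rw [closure_subtype, Subtype.image_preimage_coe]
    exact hy.2
  · obtain ⟨O, hO, hxO, hcl⟩ := h x hx
    refine ⟨Subtype.val ⁻¹' O, hO.preimage continuous_subtype_val, hxO, fun y hy => ?_⟩
    rw [closure_subtype, Subtype.image_preimage_coe] at hy
    exact hcl ⟨y.2, hy⟩

/-- A function which is constant on an open set and on its complement is weakly discontinuous. -/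
theorem weaklyDiscontinuous_of_eqOn_const {X Y : Type*} [TopologicalSpace X] [TopologicalSpace Y]
    {f : X → Y} {W : Set X} {a b : Y} (hW : IsOpen W) (ha : ∀ x ∈ W, f x = a)
    (hb : ∀ x ∉ W, f x = b) : WeaklyDiscontinuous f := by
  rintro B ⟨x, hx⟩
  by_cases h : (B ∩ W).Nonempty
  · obtain ⟨y, hyB, hyW⟩ := h
    have hWB : IsOpen (Subtype.val ⁻¹' W : Set B) := hW.preimage continuous_subtype_val
    refine ⟨⟨y, hyB⟩, mem_interior.2 ⟨_, fun z hz => ⟨z.2, ?_⟩, hWB, hyW⟩⟩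
    exact continuousAt_const.congr
      (Filter.eventually_of_mem (hWB.mem_nhds hz) fun t ht => (ha t ht).symm)
  · refine ⟨⟨x, hx⟩, mem_interior.2 ⟨univ, fun z _ => ⟨z.2, ?_⟩, isOpen_univ, mem_univ _⟩⟩
    exact continuousAt_const.congr
      (Filter.Eventually.of_forall fun t => (hb t fun ht => h ⟨t, t.2, ht⟩).symm)

theorem wThetaRegular_iff {X : Type u} [TopologicalSpace X] :
    WThetaRegular.{v, u} X ↔
      ∀ A U : Set X, U ⊆ A → U.Nonempty → IsOpen ((Subtype.val ⁻¹' U) : Set A) →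
        ∃ V : Set X, V.Nonempty ∧ V ⊆ U ∧ IsThetaOpenIn V A := by
  classical
  constructor
  · intro h A U hUA hU hUo
    obtain ⟨W, hW, hWU⟩ := hUo
    have hmem : ∀ x ∈ A, x ∈ W ↔ x ∈ U := fun x hx => Set.ext_iff.1 hWU ⟨x, hx⟩
    have hUcl : U ⊆ A ∩ closure U := subset_inter hUA subset_closure
    obtain ⟨V, hVne, hVC, hV⟩ := h (ULift Bool) inferInstance (fun x => ⟨decide (x ∈ W)⟩)
      (weaklyDiscontinuous_of_eqOn_const (a := ⟨true⟩) (b := ⟨false⟩) hW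
        (fun x hx => by simp [hx]) (fun x hx => by simp [hx])) (A ∩ closure U) (hU.mono hUcl)
    have hVU : V ⊆ U := by
      intro x hx
      obtain ⟨hxA, hc⟩ := hVC hx
      obtain ⟨O, hO, hOs⟩ := (mem_nhds_subtype _ _ _).1
        (hc.preimage_mem_nhds ((isOpen_discrete {_}).mem_nhds rfl))
      obtain ⟨y, hyO, hyU⟩ := mem_closure_iff_nhds.1 hxA.2 O hO
      have hyx : (⟨decide (y ∈ W)⟩ : ULift Bool) = ⟨decide (x ∈ W)⟩ := @hOs ⟨y, hUcl hyU⟩ hyO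
      have hyW : y ∈ W := (hmem y (hUA hyU)).2 hyU
      refine (hmem x hxA.1).1 ?_
      simpa [hyW] using hyx
    refine ⟨V, hVne, hVU, isThetaOpenIn_iff.2 ⟨hVU.trans hUA, fun x hx => ?_⟩⟩
    obtain ⟨O, hO, hxO, hcl⟩ := (isThetaOpenIn_iff.1 hV).2 x hx
    have hsub : A ∩ (O ∩ W) ⊆ U := fun y hy => (hmem y hy.1).1 hy.2.2
    refine ⟨O ∩ W, hO.inter hW, ⟨hxO, (hmem x (hUA (hVU hx))).2 (hVU hx)⟩, fun y hy => ?_⟩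
    have hsub' : A ∩ (O ∩ W) ⊆ A ∩ closure U ∩ O := fun z hz => ⟨hUcl (hsub hz), hz.2.1⟩
    exact hcl ⟨⟨hy.1, closure_mono hsub hy.2⟩, closure_mono hsub' hy.2⟩
  · intro h Y _ f hf A hA
    obtain ⟨V, hVne, hVU, hV⟩ := h A
      (Subtype.val '' interior (Subtype.val ⁻¹' ContPts f A : Set A))
      (Subtype.coe_image_subset _ _) ((hf A hA).image _)
      (by rw [preimage_image_eq _ Subtype.val_injective]; exact isOpen_interior)
    exact ⟨V, hVne, hVU.trans (image_subset_iff.2 interior_subset), hV⟩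
end

section
/- Let f : X → Y and g : Y → Z be functions between topological spaces. If f and g are both weakly discontinuous, then the composition g ∘ f : X → Z is weakly discontinuous. -/
open Set Topology TopologicalSpace

universe u v w

theorem weaklyDiscontinuous_iff_exists_continuousOn {X Y : Type*} [TopologicalSpace X]
    [TopologicalSpace Y] {f : X → Y} :
    WeaklyDiscontinuous f ↔ ∀ A : Set X, A.Nonempty →
      ∃ U : Set X, IsOpen U ∧ (A ∩ U).Nonempty ∧ ContinuousOn f (A ∩ U) := by
  refine forall₂_congr fun A _ => ⟨?_, ?_⟩
  · rintro ⟨⟨x, hxA⟩, hx⟩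
    obtain ⟨V, hV, hVo, hxV⟩ := mem_interior.1 hx
    obtain ⟨U, hU, rfl⟩ := isOpen_induced_iff.1 hVo
    refine ⟨U, hU, ⟨x, hxA, hxV⟩, fun y hy => ?_⟩
    have hyC : y ∈ ContPts f A := hV (show (⟨y, hy.1⟩ : A) ∈ Subtype.val ⁻¹' U from hy.2)
    exact (mem_contPts_iff.1 hyC).2.mono inter_subset_left
  · rintro ⟨U, hU, ⟨x, hxA, hxU⟩, hc⟩
    refine ⟨⟨x, hxA⟩, mem_interior.2 ⟨Subtype.val ⁻¹' U, fun y hy => ?_,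
      hU.preimage continuous_subtype_val, hxU⟩⟩
    exact mem_contPts_iff.2
      ⟨y.2, (continuousWithinAt_inter (hU.mem_nhds hy)).1 (hc y ⟨y.2, hy⟩)⟩

theorem weaklyDiscontinuous_comp {X : Type u} {Y : Type v} {Z : Type w}
    [TopologicalSpace X] [TopologicalSpace Y] [TopologicalSpace Z] {f : X → Y} {g : Y → Z}
    (hf : WeaklyDiscontinuous f) (hg : WeaklyDiscontinuous g) :
    WeaklyDiscontinuous (g ∘ f) := by
  rw [weaklyDiscontinuous_iff_exists_continuousOn] at *
  intro A hA
  obtain ⟨U, hU, hAU, hfc⟩ := hf A hA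
  obtain ⟨V, hV, ⟨_, ⟨x, hx, rfl⟩, hxV⟩, hgc⟩ := hg (f '' (A ∩ U)) (hAU.image f)
  obtain ⟨W, hW, hWV⟩ := continuousOn_iff'.1 hfc V hV
  have hmem : ∀ y ∈ A ∩ (U ∩ W), y ∈ A ∩ U ∧ f y ∈ V := fun y hy =>
    have h : y ∈ f ⁻¹' V ∩ (A ∩ U) := hWV ▸ ⟨hy.2.2, hy.1, hy.2.1⟩
    ⟨h.2, h.1⟩
  have hxW : x ∈ W ∩ (A ∩ U) := hWV ▸ ⟨hxV, hx⟩
  exact ⟨U ∩ W, hU.inter hW, ⟨x, hx.1, hx.2, hxW.1⟩,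
    hgc.comp (hfc.mono fun y hy => (hmem y hy).1)
      fun y hy => ⟨mem_image_of_mem f (hmem y hy).1, (hmem y hy).2⟩⟩
end

section
/- Let f : X → Y and g : Y → Z be functions between topological spaces. If f and g are both θ-weakly discontinuous, then the composition g ∘ f : X → Z is θ-weakly discontinuous. -/
open Set Topology TopologicalSpace

universe u v w

theorem IsThetaOpenIn.mem_nhdsWithin {X : Type*} [TopologicalSpace X] {V A : Set X}
    (h : IsThetaOpenIn V A) {x : X} (hx : x ∈ V) : V ∈ 𝓝[A] x := by
  obtain ⟨hVA, hV⟩ := isThetaOpenIn_iff.1 h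
  obtain ⟨O, hO, hxO, hcl⟩ := hV x hx
  exact _root_.mem_nhdsWithin.2 ⟨O, hO, hxO, fun y hy => hcl ⟨hy.2, subset_closure hy.symm⟩⟩

/-- If `f` is continuous on a θ-open subset `V` of `A`, then the preimage in `V` of a θ-open
subset of `f '' V` is θ-open in `A`. -/
theorem IsThetaOpenIn.inter_preimage {X Y : Type*} [TopologicalSpace X] [TopologicalSpace Y]
    {f : X → Y} {V A : Set X} {W : Set Y} (hV : IsThetaOpenIn V A) (hf : ContinuousOn f V)
    (hW : IsThetaOpenIn W (f '' V)) : IsThetaOpenIn (V ∩ f ⁻¹' W) A := by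
  rw [isThetaOpenIn_iff] at hV hW ⊢
  refine ⟨inter_subset_left.trans hV.1, fun x hx => ?_⟩
  obtain ⟨O, hO, hxO, hclO⟩ := hV.2 x hx.1
  obtain ⟨P, hP, hxP, hclP⟩ := hW.2 (f x) hx.2
  obtain ⟨Q, hQ, hQP⟩ := continuousOn_iff'.1 hf P hP
  have hxQ : x ∈ Q ∩ V := hQP ▸ ⟨hxP, hx.1⟩
  refine ⟨O ∩ Q, hO.inter hQ, ⟨hxO, hxQ.1⟩, fun y hy => ?_⟩
  have hsub : A ∩ (O ∩ Q) ⊆ f ⁻¹' P ∩ V := fun z hz =>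
    hQP ▸ ⟨hz.2.2, hclO ⟨hz.1, subset_closure ⟨hz.1, hz.2.1⟩⟩⟩
  have hyV : y ∈ V :=
    hclO ⟨hy.1, closure_mono (inter_subset_inter_right A inter_subset_left) hy.2⟩
  have hcont : ContinuousWithinAt f (f ⁻¹' P ∩ V) y := (hf y hyV).mono inter_subset_right
  exact ⟨hyV, hclP ⟨mem_image_of_mem f hyV, hcont.mem_closure (closure_mono hsub hy.2)
    fun z hz => ⟨mem_image_of_mem f hz.2, hz.1⟩⟩⟩

theorem thetaWeaklyDiscontinuous_comp {X : Type u} {Y : Type v} {Z : Type w}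
    [TopologicalSpace X] [TopologicalSpace Y] [TopologicalSpace Z] {f : X → Y} {g : Y → Z}
    (hf : ThetaWeaklyDiscontinuous f) (hg : ThetaWeaklyDiscontinuous g) :
    ThetaWeaklyDiscontinuous (g ∘ f) := by
  intro A hA
  obtain ⟨V, hVne, hVC, hV⟩ := hf A hA
  have hfV : ContinuousOn f V := fun x hx => (mem_contPts_iff.1 (hVC hx)).2.mono hV.1
  obtain ⟨W, ⟨w, hw⟩, hWC, hW⟩ := hg (f '' V) (hVne.image f)
  obtain ⟨x, hx, rfl⟩ := hW.1 hw
  refine ⟨V ∩ f ⁻¹' W, ⟨x, hx, hw⟩, fun y hy => ?_, hV.inter_preimage hfV hW⟩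
  have hcomp : ContinuousWithinAt (g ∘ f) V y :=
    (mem_contPts_iff.1 (hWC hy.2)).2.comp (hfV y hy.1) (mapsTo_image f V)
  exact mem_contPts_iff.2
    ⟨hV.1 hy.1, hcomp.mono_of_mem_nhdsWithin (hV.mem_nhdsWithin hy.1)⟩
end

section
/- Let f : X → Y and g : Y → Z be functions between topological spaces. If f is weakly discontinuous and g is scatteredly continuous, then the composition g ∘ f : X → Z is scatteredly continuous. -/
open Set Topology TopologicalSpace

universe u v w

/-- A weakly discontinuous function is continuous on the trace of some open set. -/
theorem WeaklyDiscontinuous.exists_isOpen {X Y : Type*} [TopologicalSpace X] [TopologicalSpace Y]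
    {f : X → Y} (hf : WeaklyDiscontinuous f) {A : Set X} (hA : A.Nonempty) :
    ∃ O : Set X, IsOpen O ∧ (A ∩ O).Nonempty ∧ A ∩ O ⊆ ContPts f A := by
  obtain ⟨a, ha⟩ := hf A hA
  obtain ⟨U, hUC, hU, haU⟩ := mem_interior.1 ha
  obtain ⟨O, hO, rfl⟩ := isOpen_induced_iff.1 hU
  exact ⟨O, hO, ⟨a, a.2, haU⟩, fun x hx => hUC (show (⟨x, hx.1⟩ : A) ∈ Subtype.val ⁻¹' O from hx.2)⟩

theorem scatteredlyContinuous_comp_of_weaklyDiscontinuous {X : Type u} {Y : Type v}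
    {Z : Type w} [TopologicalSpace X] [TopologicalSpace Y] [TopologicalSpace Z]
    {f : X → Y} {g : Y → Z}
    (hf : WeaklyDiscontinuous f) (hg : ScatteredlyContinuous g) :
    ScatteredlyContinuous (g ∘ f) := by
  intro A hA
  obtain ⟨O, hO, hne, hsub⟩ := hf.exists_isOpen hA
  obtain ⟨y, hy⟩ := hg (f '' (A ∩ O)) (hne.image f)
  obtain ⟨⟨x, hx, rfl⟩, hgx⟩ := mem_contPts_iff.1 hy
  have hfx : ContinuousWithinAt f (A ∩ O) x :=
    (mem_contPts_iff.1 (hsub hx)).2.mono inter_subset_left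
  exact ⟨x, mem_contPts_iff.2 ⟨hx.1, (continuousWithinAt_inter (hO.mem_nhds hx.2)).1
    (hgx.comp hfx (mapsTo_image f _))⟩⟩
end

section
/- Let f : X → Y and g : Y → Z be functions between topological spaces. If f is scatteredly continuous and g is θ-weakly discontinuous, then the composition g ∘ f : X → Z is scatteredly continuous. -/
open Set Topology TopologicalSpace

universe u v w

theorem ScatteredlyContinuous.exists_continuousWithinAt {X Y : Type*} [TopologicalSpace X]
    [TopologicalSpace Y] {f : X → Y} (hf : ScatteredlyContinuous f) {A : Set X}
    (hA : A.Nonempty) : ∃ x ∈ A, ContinuousWithinAt f A x := by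
  obtain ⟨x, hx⟩ := hf A hA
  exact ⟨x, mem_contPts_iff.1 hx⟩

theorem ScatteredlyContinuous.exists_continuousAt {X Y : Type*} [TopologicalSpace X]
    [TopologicalSpace Y] {f : X → Y} (hf : ScatteredlyContinuous f) {W : Set X}
    (hW : IsOpen W) (hne : W.Nonempty) : ∃ x ∈ W, ContinuousAt f x := by
  obtain ⟨x, hx, h⟩ := hf.exists_continuousWithinAt hne
  exact ⟨x, hx, h.continuousAt (hW.mem_nhds hx)⟩

theorem ScatteredlyContinuous.domRestrict {X Y : Type*} [TopologicalSpace X] [TopologicalSpace Y]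
    {f : X → Y} (hf : ScatteredlyContinuous f) (A : Set X) :
    ScatteredlyContinuous (A.domRestrict f) := by
  intro B hB
  obtain ⟨_, ⟨x, hx, rfl⟩, h⟩ := hf.exists_continuousWithinAt (hB.image Subtype.val)
  exact ⟨x, mem_contPts_iff.2 ⟨hx,
    h.comp continuous_subtype_val.continuousWithinAt (mapsTo_image _ _)⟩⟩

theorem IsThetaOpenIn.exists_isOpen {X : Type*} [TopologicalSpace X] {V A : Set X}
    (h : IsThetaOpenIn V A) {x : X} (hx : x ∈ V) :
    ∃ O : Set X, IsOpen O ∧ x ∈ O ∧ closure (O ∩ A) ∩ A ⊆ V := by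
  obtain ⟨P, hP, hxP, hPV⟩ := h.2 ⟨x, h.1 hx⟩ hx
  obtain ⟨O, hO, rfl⟩ := isOpen_induced_iff.1 hP
  refine ⟨O, hO, hxP, ?_⟩
  rintro z ⟨hz, hzA⟩
  refine @hPV ⟨z, hzA⟩ (closure_subtype.2 ?_)
  rwa [Subtype.image_preimage_coe, inter_comm]

/-- A θ-weakly discontinuous function admits a transfinite stratification of its domain into
relatively θ-open layers, each consisting of continuity points of the restriction to the
corresponding tail. -/
theorem ThetaWeaklyDiscontinuous.exists_rank {Y : Type v} {Z : Type w} [TopologicalSpace Y]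
    [TopologicalSpace Z] {g : Y → Z} (hg : ThetaWeaklyDiscontinuous g) :
    ∃ (r : Y → Ordinal.{v}) (α : Ordinal.{v}), (∀ y, r y < α) ∧
      ∀ y, ContinuousWithinAt g {z | r y ≤ r z} y ∧
        ∃ O : Set Y, IsOpen O ∧ y ∈ O ∧
          closure (O ∩ {z | r y ≤ r z}) ∩ {z | r y ≤ r z} ⊆ {z | r z = r y} := by
  have key : ∀ F : Set Y, ∃ V : Set Y, (F.Nonempty → V.Nonempty) ∧ V ⊆ ContPts g F ∧
      IsThetaOpenIn V F := by
    intro F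
    rcases F.eq_empty_or_nonempty with rfl | hF
    · exact ⟨∅, by simp, by simp, by simp, fun x hx => hx.elim⟩
    · obtain ⟨V, h1, h2⟩ := hg F hF
      exact ⟨V, fun _ => h1, h2⟩
  choose V hVne hVc hVt using key
  let U : Ordinal.{v} → Set Y := WellFounded.fix (C := fun _ => Set Y)
    (wellFounded_lt (α := Ordinal.{v})) fun α u => V {y | ∀ β, ∀ h : β < α, y ∉ u β h}
  let F : Ordinal.{v} → Set Y := fun α => {y | ∀ β < α, y ∉ U β}
  have hU : ∀ α, U α = V (F α) := fun α => WellFounded.fix_eq _ _ _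
  have hcover : ∃ α, F α = ∅ := by
    by_contra! hne
    have hlt : ∀ α β, β < α → U β ≠ U α := by
      intro α β hβ he
      obtain ⟨y, hy⟩ := hVne _ (hne α)
      have h1 : y ∈ F α := (hVt _).1 hy
      rw [← hU, ← he] at hy
      exact h1 β hβ hy
    refine not_injective_of_ordinal U fun α β h => ?_
    rcases lt_trichotomy α β with h' | h' | h'
    · exact (hlt _ _ h' h).elim
    · exact h'
    · exact (hlt _ _ h' h.symm).elim
  obtain ⟨α, hα⟩ := hcover
  have hex : ∀ y, ∃ β, β < α ∧ y ∈ U β := by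
    intro y
    by_contra! h
    exact (hα ▸ (show y ∈ F α from h) : y ∈ (∅ : Set Y))
  choose r hr hrU using hex
  have hUF : ∀ {y β}, y ∈ U β → y ∈ F β := fun {y β} h => (hVt _).1 (hU β ▸ h)
  have huniq : ∀ {y β}, y ∈ U β → r y = β := by
    intro y β h
    rcases lt_trichotomy (r y) β with h' | h' | h'
    · exact (hUF h _ h' (hrU y)).elim
    · exact h'
    · exact (hUF (hrU y) _ h' h).elim
  have hF : ∀ β, {z | β ≤ r z} = F β := by
    intro β
    ext z
    constructor
    · intro h γ hγ hz
      exact (huniq hz ▸ (show β ≤ r z from h)).not_gt hγ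
    · intro h
      exact not_lt.1 fun h' => h _ h' (hrU z)
  refine ⟨r, α, hr, fun y => ?_⟩
  have hy : y ∈ V (F (r y)) := hU (r y) ▸ hrU y
  rw [hF]
  refine ⟨(mem_contPts_iff.1 (hVc _ hy)).2, ?_⟩
  obtain ⟨O, hO, hyO, hsub⟩ := (hVt _).exists_isOpen hy
  exact ⟨O, hO, hyO, fun z hz => huniq ((hU (r y)).symm ▸ hsub hz)⟩

theorem IsNowhereDense.nonempty_diff_closure {X : Type*} [TopologicalSpace X] {G W : Set X}
    (hG : IsNowhereDense G) (hW : IsOpen W) (hne : W.Nonempty) : (W \ closure G).Nonempty := by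
  by_contra h
  have hsub : W ⊆ interior (closure G) :=
    interior_maximal (sdiff_eq_empty.1 (not_nonempty_iff_eq_empty.1 h)) hW
  rw [hG] at hsub
  exact hne.ne_empty (subset_empty_iff.1 hsub)

theorem ScatteredlyContinuous.exists_continuousAt_comp {X : Type u} {Y : Type v} {Z : Type w}
    [TopologicalSpace X] [TopologicalSpace Y] [TopologicalSpace Z] [Nonempty X]
    {f : X → Y} {g : Y → Z} (hf : ScatteredlyContinuous f) (hg : ThetaWeaklyDiscontinuous g) :
    ∃ x, ContinuousAt (g ∘ f) x := by
  obtain ⟨r, α₀, hα₀, hr⟩ := hg.exists_rank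
  let G : Ordinal.{v} → Set X := fun α => {x | r (f x) < α}
  have hex : ∃ α, ¬ IsNowhereDense (G α) := by
    refine ⟨α₀, fun h => ?_⟩
    have : G α₀ = univ := eq_univ_of_forall fun x => hα₀ _
    rw [this, IsNowhereDense, closure_univ, interior_univ] at h
    exact univ_nonempty.ne_empty h
  obtain ⟨α, hα, hmin⟩ := wellFounded_lt.has_min {α | ¬ IsNowhereDense (G α)} hex
  replace hmin : ∀ β < α, IsNowhereDense (G β) := fun β h => by
    by_contra h'
    exact hmin β h' h
  set W := interior (closure (G α))
  have hW : IsOpen W := isOpen_interior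
  have hWne : W.Nonempty := nonempty_iff_ne_empty.2 hα
  by_cases hcase : ∃ c ∈ W, ContinuousAt f c ∧ r (f c) < α
  · obtain ⟨c, -, hc, hcα⟩ := hcase
    obtain ⟨-, O, hO, hcO, hsub⟩ := hr (f c)
    obtain ⟨W₁, hW₁O, hW₁, hcW₁⟩ := mem_nhds_iff.1 (hc (hO.mem_nhds hcO))
    have hopen : IsOpen (W₁ \ closure (G (r (f c)))) := hW₁.sdiff isClosed_closure
    obtain ⟨x, hx, hxc⟩ := hf.exists_continuousAt hopen
      ((hmin _ hcα).nonempty_diff_closure hW₁ ⟨c, hcW₁⟩)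
    have hge : ∀ z ∈ W₁ \ closure (G (r (f c))), r (f c) ≤ r (f z) :=
      fun z hz => not_lt.1 fun h => hz.2 (subset_closure h)
    have heq : r (f x) = r (f c) :=
      hsub ⟨subset_closure ⟨hW₁O hx.1, hge x hx⟩, hge x hx⟩
    refine ⟨x, ContinuousWithinAt.continuousAt (s := W₁ \ closure (G (r (f c)))) ?_
      (hopen.mem_nhds hx)⟩
    exact (hr (f x)).1.comp hxc.continuousWithinAt fun z hz => heq.trans_le (hge z hz)
  · push Not at hcase
    have hWG : ∀ W' : Set X, IsOpen W' → W' ⊆ W → ∀ c ∈ W', c ∈ closure (W' ∩ G α) :=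
      fun W' hW' hsub c hc => hW'.inter_closure ⟨hc, interior_subset (hsub hc)⟩
    obtain ⟨w, hw⟩ := hWne
    obtain ⟨x, ⟨hxW, hxα⟩, hx⟩ := hf.exists_continuousWithinAt
      (closure_nonempty_iff.1 ⟨w, hWG W hW subset_rfl w hw⟩)
    obtain ⟨-, O, hO, hxO, hsub⟩ := hr (f x)
    obtain ⟨W₁, hW₁, hxW₁, hW₁O⟩ := mem_nhdsWithin.1 (hx (hO.mem_nhds hxO))
    have hopen : IsOpen ((W₁ ∩ W) \ closure (G (r (f x)))) :=
      (hW₁.inter hW).sdiff isClosed_closure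
    obtain ⟨c, hcW, hc⟩ := hf.exists_continuousAt hopen
      ((hmin _ hxα).nonempty_diff_closure (hW₁.inter hW) ⟨x, hxW₁, hxW⟩)
    have hcα : α ≤ r (f c) := hcase c hcW.1.2 hc
    have hcl : f c ∈ closure (O ∩ {z | r (f x) ≤ r z}) := by
      refine hc.continuousWithinAt.mem_closure
        (hWG _ hopen (fun z hz => hz.1.2) c hcW) ?_
      rintro z ⟨⟨⟨hz₁, hzW⟩, hzG⟩, hzα⟩
      have hge : r (f x) ≤ r (f z) := not_lt.1 fun h => hzG (subset_closure h)
      exact ⟨hW₁O ⟨hz₁, hzW, hzα⟩, hge⟩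
    have heq : r (f c) = r (f x) := hsub ⟨hcl, (hxα.trans_le hcα).le⟩
    exact ((hxα.trans_le hcα).ne' heq).elim

theorem scatteredlyContinuous_comp_of_thetaWeaklyDiscontinuous {X : Type u} {Y : Type v}
    {Z : Type w} [TopologicalSpace X] [TopologicalSpace Y] [TopologicalSpace Z]
    {f : X → Y} {g : Y → Z}
    (hf : ScatteredlyContinuous f) (hg : ThetaWeaklyDiscontinuous g) :
    ScatteredlyContinuous (g ∘ f) := by
  intro A hA
  have := hA.to_subtype
  obtain ⟨x, hx⟩ := (hf.domRestrict A).exists_continuousAt_comp hg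
  exact ⟨x, x.2, hx⟩
end

section
/- Every wθ-regular topological space is hereditarily quasi-regular; that is, every subspace A of a wθ-regular space X is quasi-regular. -/
open Set Topology TopologicalSpace

universe u v w

/-- The indicator function of a set, with values in a two-point type of any universe. -/
def indicatorLift {X : Type u} (W : Set X) (x : X) : ULift.{v} Prop := ⟨x ∈ W⟩

/-- The restriction to `B` of the indicator of `W`, with values in a discrete space, is
continuous at `x` iff membership in `W` is constant near `x` in `B`. -/
theorem mem_contPts_indicatorLift_iff {X : Type u} [TopologicalSpace X] {W B : Set X} {x : X} :
    x ∈ @ContPts X (ULift.{v} Prop) _ ⊥ (indicatorLift W) B ↔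
      ∃ _ : x ∈ B, ∀ᶠ y in 𝓝[B] x, (y ∈ W ↔ x ∈ W) := by
  let _ : TopologicalSpace (ULift.{v} Prop) := ⊥
  have : DiscreteTopology (ULift.{v} Prop) := ⟨rfl⟩
  refine exists_congr fun hx => ?_
  rw [ContinuousAt, nhds_discrete (ULift.{v} Prop), Filter.tendsto_pure,
    nhdsWithin_eq_map_subtype_coe hx, Filter.eventually_map]
  refine Filter.eventually_congr (.of_forall fun y => ?_)
  change ULift.up (y.1 ∈ W) = ULift.up (x ∈ W) ↔ _
  rw [ULift.up_inj, eq_iff_iff]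

/-- The indicator of an open set, with values in a discrete space, is weakly discontinuous. -/
theorem IsOpen.weaklyDiscontinuous_indicatorLift {X : Type u} [TopologicalSpace X] {W : Set X}
    (hW : IsOpen W) :
    @WeaklyDiscontinuous X (ULift.{v} Prop) _ ⊥ (indicatorLift W) := by
  rintro S ⟨s, hs⟩
  by_cases h : (S ∩ W).Nonempty
  · obtain ⟨x, hxS, hxW⟩ := h
    refine ⟨⟨x, hxS⟩, mem_interior.2 ⟨Subtype.val ⁻¹' W, fun y hy => ?_,
      hW.preimage continuous_subtype_val, hxW⟩⟩
    refine mem_contPts_indicatorLift_iff.2 ⟨y.2, ?_⟩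
    filter_upwards [mem_nhdsWithin_of_mem_nhds (hW.mem_nhds hy)] with z hz
    exact iff_of_true hz hy
  · have hS : ∀ z ∈ S, z ∉ W := fun z hz hzW => h ⟨z, hz, hzW⟩
    refine ⟨⟨s, hs⟩, mem_interior.2 ⟨univ, fun y _ => ?_, isOpen_univ, mem_univ _⟩⟩
    refine mem_contPts_indicatorLift_iff.2 ⟨y.2, ?_⟩
    filter_upwards [self_mem_nhdsWithin] with z hz
    exact iff_of_false (hS z hz) (hS y y.2)

theorem quasiRegular_subspace_of_wThetaRegular {X : Type u} [TopologicalSpace X]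
    (hX : WThetaRegular.{v, u} X) (A : Set X) (U : Set A) (hU : IsOpen U) (hne : U.Nonempty) :
    ∃ V : Set A, IsOpen V ∧ V.Nonempty ∧ closure V ⊆ U := by
  obtain ⟨W, hW, rfl⟩ := isOpen_induced_iff.1 hU
  obtain ⟨a, ha⟩ := hne
  set B : Set X := A ∩ closure (A ∩ W) with hB
  have hWB : A ∩ W ⊆ B := fun y hy => ⟨hy.1, subset_closure hy⟩
  obtain ⟨V, ⟨x, hxV⟩, hVC, hVB, hV⟩ :=
    hX _ ⊥ (indicatorLift W) hW.weaklyDiscontinuous_indicatorLift B ⟨a, hWB ⟨a.2, ha⟩⟩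
  have hVW : V ⊆ W := by
    intro y hy
    obtain ⟨hyB, hc⟩ := mem_contPts_indicatorLift_iff.1 (hVC hy)
    have : ∃ᶠ z in 𝓝 y, z ∈ A ∩ W := mem_closure_iff_frequently.1 hyB.2
    obtain ⟨z, hz, h⟩ := (this.and_eventually (eventually_nhdsWithin_iff.1 hc)).exists
    exact (h (hWB hz)).1 hz.2
  obtain ⟨O, hO, hxO, hcl⟩ := hV ⟨x, hVB hxV⟩ hxV
  obtain ⟨G, hG, rfl⟩ := isOpen_induced_iff.1 hO
  refine ⟨Subtype.val ⁻¹' (G ∩ W), (hG.inter hW).preimage continuous_subtype_val,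
    ⟨⟨x, (hVB hxV).1⟩, hxO, hVW hxV⟩, fun y hy => ?_⟩
  rw [closure_subtype] at hy
  have hyB : y.1 ∈ B := by
    refine ⟨y.2, closure_mono ?_ hy⟩
    rintro _ ⟨z, hz, rfl⟩
    exact ⟨z.2, hz.2⟩
  refine hVW (hcl (a := ⟨y.1, hyB⟩) (closure_subtype.2 (closure_mono ?_ hy)))
  rintro _ ⟨z, hz, rfl⟩
  exact ⟨⟨z.1, hWB ⟨z.2, hz.2⟩⟩, hz.1, rfl⟩
end

section
/- Every locally regular topological space is sw-regular; that is, if Y is a topological space admitting an open cover by regular subspaces, then every scatteredly continuous function f : X → Y from any topological space X is weakly discontinuous. -/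
open Set Topology TopologicalSpace

universe u v w

theorem IsOpen.exists_mem_nhds_closure_inter_subset {Y : Type*} [TopologicalSpace Y] {U : Set Y}
    (hU : IsOpen U) [RegularSpace U] {y : Y} (hy : y ∈ U) {W : Set Y} (hW : W ∈ 𝓝 y) :
    ∃ V ∈ 𝓝 y, closure V ∩ U ⊆ W := by
  have hW' : (Subtype.val ⁻¹' W : Set U) ∈ 𝓝 ⟨y, hy⟩ :=
    continuous_subtype_val.continuousAt.preimage_mem_nhds hW
  obtain ⟨T, hT, hTc, hTW⟩ := exists_mem_nhds_isClosed_subset hW'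
  refine ⟨Subtype.val '' T, hU.isOpenEmbedding_subtypeVal.image_mem_nhds.2 hT, ?_⟩
  rintro z ⟨hz, hzU⟩
  have : (⟨z, hzU⟩ : U) ∈ closure T := closure_subtype.2 hz
  rw [hTc.closure_eq] at this
  exact hTW this

theorem ScatteredlyContinuous.exists_isOpen_forall_continuousWithinAt {X Y : Type*}
    [TopologicalSpace X] [TopologicalSpace Y] {f : X → Y} (hf : ScatteredlyContinuous f)
    {A : Set X} {U : Set Y} (hU : IsOpen U) [RegularSpace U] {c : X} (hcA : c ∈ A)
    (hc : ContinuousWithinAt f A c) (hcU : f c ∈ U) :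
    ∃ G : Set X, IsOpen G ∧ (G ∩ A).Nonempty ∧ ∀ x ∈ G ∩ A, ContinuousWithinAt f A x := by
  obtain ⟨O, hO, hcO, hOU⟩ := mem_nhdsWithin.1 (hc (hU.mem_nhds hcU))
  by_contra! hcon
  let D : Set X := {x | x ∈ O ∩ A ∧ ¬ ContinuousWithinAt f A x}
  obtain ⟨d, hd⟩ := hcon O hO ⟨c, hcO, hcA⟩
  obtain ⟨x₀, hx₀⟩ := hf D ⟨d, hd⟩
  obtain ⟨hx₀D, hx₀c⟩ := mem_contPts_iff.1 hx₀
  refine hx₀D.2 fun W hW => ?_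
  obtain ⟨V, hV, hVW⟩ := hU.exists_mem_nhds_closure_inter_subset (hOU hx₀D.1) hW
  obtain ⟨P, hP, hx₀P, hPV⟩ := mem_nhdsWithin.1 (hx₀c hV)
  refine mem_nhdsWithin.2 ⟨P ∩ O, hP.inter hO, ⟨hx₀P, hx₀D.1.1⟩, ?_⟩
  rintro x ⟨⟨hxP, hxO⟩, hxA⟩
  refine hVW ⟨?_, hOU ⟨hxO, hxA⟩⟩
  by_cases hx : ContinuousWithinAt f A x
  · have hxcl : x ∈ closure (P ∩ D) := by
      refine mem_closure_iff.2 fun G hG hxG => ?_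
      obtain ⟨z, ⟨⟨hzG, hzP, hzO⟩, hzA⟩, hz⟩ :=
        hcon (G ∩ (P ∩ O)) (hG.inter (hP.inter hO)) ⟨x, ⟨hxG, hxP, hxO⟩, hxA⟩
      exact ⟨z, hzG, hzP, ⟨hzO, hzA⟩, hz⟩
    have hsub : P ∩ D ⊆ A := fun z hz => hz.2.1.2
    exact closure_mono (image_subset_iff.2 hPV) ((hx.mono hsub).mem_closure_image hxcl)
  · exact subset_closure (hPV ⟨hxP, ⟨hxO, hxA⟩, hx⟩)

theorem swRegular_of_locallyRegular {Y : Type v} [TopologicalSpace Y]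
    (hreg : ∃ 𝒰 : Set (Set Y), (∀ U ∈ 𝒰, IsOpen U ∧ RegularSpace U) ∧ ⋃₀ 𝒰 = Set.univ) :
    SwRegular.{u, v} Y := by
  obtain ⟨𝒰, h𝒰, hcov⟩ := hreg
  intro Z _ f hf A hA
  obtain ⟨c, hc⟩ := hf A hA
  obtain ⟨hcA, hc⟩ := mem_contPts_iff.1 hc
  obtain ⟨U, hU, hcU⟩ := sUnion_eq_univ_iff.1 hcov (f c)
  obtain ⟨hUo, _⟩ := h𝒰 U hU
  obtain ⟨G, hG, ⟨x, hxG, hxA⟩, hGc⟩ :=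
    hf.exists_isOpen_forall_continuousWithinAt hUo hcA hc hcU
  exact ⟨⟨x, hxA⟩, mem_interior.2 ⟨Subtype.val ⁻¹' G,
    fun z hz => mem_contPts_iff.2 ⟨z.2, hGc z ⟨hz, z.2⟩⟩,
    hG.preimage continuous_subtype_val, hxG⟩⟩
end

section
/- The Gutik hedgehog is first-countable, scattered, and locally regular, but it is not a regular topological space. -/
open Set Topology TopologicalSpace

universe u v w

/-- The underlying set of the Gutik hedgehog: sequences of natural numbers of length
at most `2`.  `root` is the empty sequence, `spine n` the one-element sequence `(n)`,
and `tip n m` the two-element sequence `(n, m)`. -/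
inductive GutikPoint : Type
  | root : GutikPoint
  | spine (n : ℕ) : GutikPoint
  | tip (n m : ℕ) : GutikPoint

namespace GutikPoint

/-- The basic neighborhood `U_n = {∅} ∪ {(i,j) ∈ ℕ² : i ≥ n}` of the root. -/
def Un (n : ℕ) : Set GutikPoint :=
  {x | x = root ∨ ∃ i j, n ≤ i ∧ x = tip i j}

/-- The basic neighborhood `U_{n,m} = {(n)} ∪ {(n,j) : j ≥ m}` of the spine point `(n)`. -/
def Unm (n m : ℕ) : Set GutikPoint :=
  {x | x = spine n ∨ ∃ j, m ≤ j ∧ x = tip n j}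

/-- The topology of the Gutik hedgehog, generated by the base consisting of the
singletons of points of `ℕ²` and the sets `U_n` and `U_{n,m}`. -/
instance : TopologicalSpace GutikPoint :=
  TopologicalSpace.generateFrom
    {S | (∃ n m, S = {tip n m}) ∨ (∃ n, S = Un n) ∨ (∃ n m, S = Unm n m)}

end GutikPoint

namespace GutikPoint

lemma isOpen_iff {S : Set GutikPoint} :
    IsOpen S ↔ (root ∈ S → ∃ n, Un n ⊆ S) ∧ ∀ n, spine n ∈ S → ∃ m, Unm n m ⊆ S := by
  constructor
  · intro h
    induction h with
    | basic s hs =>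
      rcases hs with ⟨n, m, rfl⟩ | ⟨n, rfl⟩ | ⟨n, m, rfl⟩
      · simp
      · exact ⟨fun _ => ⟨n, subset_rfl⟩, by simp [Un]⟩
      · refine ⟨by simp [Unm], fun k hk => ⟨m, ?_⟩⟩
        obtain rfl : k = n := by simpa [Unm] using hk
        exact subset_rfl
    | univ => simp
    | inter s t _ _ hs ht =>
      refine ⟨fun hr => ?_, fun n hn => ?_⟩
      · obtain ⟨a, ha⟩ := hs.1 hr.1
        obtain ⟨b, hb⟩ := ht.1 hr.2
        refine ⟨max a b, fun x hx => ⟨ha ?_, hb ?_⟩⟩ <;>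
          simp only [Un, mem_ofPred_eq] at hx ⊢ <;> grind
      · obtain ⟨a, ha⟩ := hs.2 n hn.1
        obtain ⟨b, hb⟩ := ht.2 n hn.2
        refine ⟨max a b, fun x hx => ⟨ha ?_, hb ?_⟩⟩ <;>
          simp only [Unm, mem_ofPred_eq] at hx ⊢ <;> grind
    | sUnion 𝒮 _ ih =>
      refine ⟨fun ⟨s, hs, hr⟩ => ?_, fun n ⟨s, hs, hn⟩ => ?_⟩
      · exact ((ih s hs).1 hr).imp fun _ h => h.trans (subset_sUnion_of_mem hs)
      · exact ((ih s hs).2 n hn).imp fun _ h => h.trans (subset_sUnion_of_mem hs)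
  · rintro ⟨hr, hs⟩
    refine isOpen_iff_forall_mem_open.2 fun x hx => ?_
    match x, hx with
    | root, hx =>
      obtain ⟨n, hn⟩ := hr hx
      exact ⟨_, hn, .basic _ (.inr (.inl ⟨n, rfl⟩)), .inl rfl⟩
    | spine k, hx =>
      obtain ⟨m, hm⟩ := hs k hx
      exact ⟨_, hm, .basic _ (.inr (.inr ⟨k, m, rfl⟩)), .inl rfl⟩
    | tip i j, hx =>
      exact ⟨{tip i j}, singleton_subset_iff.2 hx, .basic _ (.inl ⟨i, j, rfl⟩), rfl⟩

lemma isOpen_Un (n : ℕ) : IsOpen (Un n) := .basic _ (.inr (.inl ⟨n, rfl⟩))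

lemma isOpen_Unm (n m : ℕ) : IsOpen (Unm n m) := .basic _ (.inr (.inr ⟨n, m, rfl⟩))

lemma isOpen_singleton_tip (i j : ℕ) : IsOpen {tip i j} := .basic _ (.inl ⟨i, j, rfl⟩)

lemma isOpen_compl_singleton_tip (i j : ℕ) : IsOpen ({tip i j}ᶜ : Set GutikPoint) := by
  refine isOpen_iff.2 ⟨fun _ => ⟨i + 1, ?_⟩, fun n _ => ⟨j + 1, ?_⟩⟩ <;> intro x hx <;>
    simp only [Un, Unm, mem_ofPred_eq, mem_compl_iff, mem_singleton_iff] at hx ⊢ <;> grind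

instance : SecondCountableTopology GutikPoint := by
  refine ⟨⟨_, ?_, rfl⟩⟩
  refine ((countable_range fun p : ℕ × ℕ => ({tip p.1 p.2} : Set GutikPoint)).union
    ((countable_range Un).union (countable_range fun p : ℕ × ℕ => Unm p.1 p.2))).mono ?_
  rintro S (⟨n, m, rfl⟩ | ⟨n, rfl⟩ | ⟨n, m, rfl⟩)
  · exact .inl ⟨(n, m), rfl⟩
  · exact .inr (.inl ⟨n, rfl⟩)
  · exact .inr (.inr ⟨(n, m), rfl⟩)

lemma exists_isOpen_inter_eq_singleton {A : Set GutikPoint} (hA : A.Nonempty) :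
    ∃ a ∈ A, ∃ U : Set GutikPoint, IsOpen U ∧ U ∩ A = {a} := by
  by_cases ht : ∃ i j, tip i j ∈ A
  · obtain ⟨i, j, h⟩ := ht
    exact ⟨_, h, _, isOpen_singleton_tip i j, inter_eq_left.2 (singleton_subset_iff.2 h)⟩
  by_cases hs : ∃ n, spine n ∈ A
  · obtain ⟨n, h⟩ := hs
    refine ⟨_, h, _, isOpen_Unm n 0, ?_⟩
    ext x
    simp only [Unm, mem_inter_iff, mem_ofPred_eq, mem_singleton_iff]
    grind
  · obtain ⟨x, hx⟩ := hA
    have hr : root ∈ A := by cases x <;> grind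
    refine ⟨_, hr, _, isOpen_Un 0, ?_⟩
    ext x
    simp only [Un, mem_inter_iff, mem_ofPred_eq, mem_singleton_iff]
    grind

end GutikPoint

/-- A subspace in which every point has a neighborhood base of relatively clopen sets is regular. -/
lemma regularSpace_subtype_of_clopen {X : Type*} [TopologicalSpace X] {U : Set X}
    (h : ∀ x ∈ U, ∀ W, IsOpen W → x ∈ W →
      ∃ V ⊆ W, IsOpen V ∧ x ∈ V ∧ IsOpen (Vᶜ ∩ U)) : RegularSpace U := by
  refine .of_exists_mem_nhds_isClosed_subset fun x s hs => ?_
  obtain ⟨t, ht, hts⟩ := mem_nhds_subtype U x s |>.1 hs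
  obtain ⟨W, hWt, hW, hxW⟩ := mem_nhds_iff.1 ht
  obtain ⟨V, hVW, hV, hxV, hVU⟩ := h x x.2 W hW hxW
  refine ⟨Subtype.val ⁻¹' V, (hV.preimage continuous_subtype_val).mem_nhds hxV, ⟨?_⟩,
    (preimage_mono (hVW.trans hWt)).trans hts⟩
  convert hVU.preimage continuous_subtype_val using 1
  ext y
  simp

namespace GutikPoint

lemma regularSpace_Un (n : ℕ) : RegularSpace (Un n) := by
  refine regularSpace_subtype_of_clopen fun x hx W hW hxW => ?_
  rcases hx with rfl | ⟨i, j, -, rfl⟩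
  · obtain ⟨k, hk⟩ := (isOpen_iff.1 hW).1 hxW
    exact ⟨_, hk, isOpen_Un k, .inl rfl, isOpen_iff.2 ⟨by simp [Un], by simp [Un]⟩⟩
  · exact ⟨_, singleton_subset_iff.2 hxW, isOpen_singleton_tip i j, rfl,
      (isOpen_compl_singleton_tip i j).inter (isOpen_Un n)⟩

lemma regularSpace_Unm (n m : ℕ) : RegularSpace (Unm n m) := by
  refine regularSpace_subtype_of_clopen fun x hx W hW hxW => ?_
  rcases hx with rfl | ⟨j, -, rfl⟩
  · obtain ⟨k, hk⟩ := (isOpen_iff.1 hW).2 n hxW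
    refine ⟨_, hk, isOpen_Unm n k, .inl rfl, isOpen_iff.2 ⟨by simp [Unm], fun l hl => ?_⟩⟩
    simp only [Unm, mem_inter_iff, mem_compl_iff, mem_ofPred_eq] at hl
    grind
  · exact ⟨_, singleton_subset_iff.2 hxW, isOpen_singleton_tip n j, rfl,
      (isOpen_compl_singleton_tip n j).inter (isOpen_Unm n m)⟩

lemma not_regularSpace : ¬ RegularSpace GutikPoint := by
  intro _
  obtain ⟨C, hC, hCc, hCU⟩ :=
    exists_mem_nhds_isClosed_subset ((isOpen_Un 0).mem_nhds (x := root) (.inl rfl))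
  obtain ⟨V, hVC, hV, hrV⟩ := mem_nhds_iff.1 hC
  obtain ⟨n, hn⟩ := (isOpen_iff.1 hV).1 hrV
  have hs : spine n ∈ Cᶜ := fun h => by simpa [Un] using hCU h
  obtain ⟨m, hm⟩ := (isOpen_iff.1 hCc.isOpen_compl).2 n hs
  exact hm (.inr ⟨m, le_rfl, rfl⟩) (hVC (hn (.inr ⟨n, m, le_rfl, rfl⟩)))

end GutikPoint

theorem gutik_hedgehog_properties :
    FirstCountableTopology GutikPoint ∧
    (∀ A : Set GutikPoint, A.Nonempty →
      ∃ a ∈ A, ∃ U : Set GutikPoint, IsOpen U ∧ U ∩ A = {a}) ∧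
    (∃ 𝒰 : Set (Set GutikPoint), (∀ U ∈ 𝒰, IsOpen U ∧ RegularSpace U) ∧ ⋃₀ 𝒰 = Set.univ) ∧
    ¬ RegularSpace GutikPoint := by
  refine ⟨inferInstance, fun A => GutikPoint.exists_isOpen_inter_eq_singleton,
    ⟨{U | IsOpen U ∧ RegularSpace U}, fun U hU => hU, eq_univ_of_forall fun x => ?_⟩,
    GutikPoint.not_regularSpace⟩
  match x with
  | .root => exact ⟨_, ⟨GutikPoint.isOpen_Un 0, GutikPoint.regularSpace_Un 0⟩, .inl rfl⟩
  | .spine n => exact ⟨_, ⟨GutikPoint.isOpen_Unm n 0, GutikPoint.regularSpace_Unm n 0⟩, .inl rfl⟩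
  | .tip i j =>
    exact ⟨_, ⟨GutikPoint.isOpen_Un 0, GutikPoint.regularSpace_Un 0⟩, .inr ⟨i, j, i.zero_le, rfl⟩⟩
end
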